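/- ∫₀^∞ tanh(z)³/z³ dz = -7 ζ(3)/π² + 186 ζ(5)/π⁴. -/

import Mathlib

open Real MeasureTheory

open Filter Topology

/-- The positive numbers `a` for which `a * I` is a pole of `tanh`. -/
noncomputable def tanhPole (n : ℕ) : ℝ := (2 * n + 1) * π / 2

lemma tanhPole_pos (n : ℕ) : 0 < tanhPole n := by
  unfold tanhPole; positivity

lemma hasSum_one_div_odd_pow {s : ℕ} (hs : 1 < s) :
    HasSum (fun n : ℕ => 1 / (2 * n + 1 : ℝ) ^ s)
      ((1 - 1 / 2 ^ s) * ∑' n : ℕ, 1 / (n : ℝ) ^ s) := by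
  have h := Real.summable_one_div_nat_pow.mpr hs
  have hodd : Summable fun n : ℕ => 1 / ((2 * n + 1 : ℕ) : ℝ) ^ s :=
    h.comp_injective (i := fun n : ℕ => 2 * n + 1) fun a b hab => by simpa using hab
  have heven : HasSum (fun n : ℕ => 1 / ((2 * n : ℕ) : ℝ) ^ s)
      (1 / 2 ^ s * ∑' n : ℕ, 1 / (n : ℝ) ^ s) := by
    convert! h.hasSum.mul_left (1 / 2 ^ s : ℝ) using 2 with n
    push_cast
    rw [mul_pow]
    field_simp
  have htot := (heven.even_add_odd (f := fun n : ℕ => 1 / (n : ℝ) ^ s) hodd.hasSum).unique h.hasSum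
  convert hodd.hasSum using 1
  · push_cast; rfl
  · linarith

lemma hasSum_one_div_tanhPole_pow {s : ℕ} (hs : 1 < s) :
    HasSum (fun n => 1 / tanhPole n ^ s)
      ((2 ^ s - 1) / π ^ s * ∑' n : ℕ, 1 / (n : ℝ) ^ s) := by
  convert! (hasSum_one_div_odd_pow hs).mul_left ((2 / π) ^ s) using 1
  · ext n
    rw [tanhPole, div_pow, div_pow, mul_pow]
    field_simp
  · rw [div_pow]; field_simp

lemma hasSum_one_div_tanhPole_sq : HasSum (fun n => 1 / tanhPole n ^ 2) (1 / 2) := by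
  convert! hasSum_one_div_tanhPole_pow (s := 2) (by norm_num) using 1
  rw [hasSum_zeta_two.tsum_eq]
  field_simp; norm_num

lemma hasSum_one_div_tanhPole_pow_four : HasSum (fun n => 1 / tanhPole n ^ 4) (1 / 6) := by
  convert! hasSum_one_div_tanhPole_pow (s := 4) (by norm_num) using 1
  rw [hasSum_zeta_four.tsum_eq]
  field_simp; norm_num

section PartialFractions

variable {z : ℝ}

lemma half_add_mem_upperHalfPlaneSet (hz : 0 < z) :
    (1 / 2 + Complex.I * z / π : ℂ) ∈ UpperHalfPlane.upperHalfPlaneSet := by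
  have h : (1 / 2 + Complex.I * z / π : ℂ) = ((1 / 2 : ℝ) : ℂ) + ((z / π : ℝ) : ℂ) * Complex.I := by
    push_cast; ring
  simp only [UpperHalfPlane.upperHalfPlaneSet, Set.mem_ofPred_eq, h, Complex.add_im,
    Complex.ofReal_im, Complex.im_ofReal_mul, Complex.I_im]
  simp only [mul_one, zero_add]
  positivity

lemma half_add_add_eq (z : ℝ) (n : ℂ) :
    (1 / 2 + Complex.I * z / π + n : ℂ) = (Complex.I * z + (2 * n + 1) * π / 2) / π := by
  have : (π : ℂ) ≠ 0 := by exact_mod_cast pi_ne_zero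
  field_simp
  ring

lemma sin_pi_mul_half_add (z : ℝ) :
    Complex.sin (π * (1 / 2 + Complex.I * z / π)) = Real.cosh z := by
  have : (π : ℂ) ≠ 0 := by exact_mod_cast pi_ne_zero
  rw [show (π * (1 / 2 + Complex.I * z / π) : ℂ) = z * Complex.I + π / 2 by field_simp; ring,
    Complex.sin_add_pi_div_two, Complex.cos_mul_I, Complex.ofReal_cosh]

lemma cos_pi_mul_half_add (z : ℝ) :
    Complex.cos (π * (1 / 2 + Complex.I * z / π)) = -(Real.sinh z * Complex.I) := by
  have : (π : ℂ) ≠ 0 := by exact_mod_cast pi_ne_zero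
  rw [show (π * (1 / 2 + Complex.I * z / π) : ℂ) = z * Complex.I + π / 2 by field_simp; ring,
    Complex.cos_add_pi_div_two, Complex.sin_mul_I, Complex.ofReal_sinh]

lemma I_mul_add_ne_zero (hz : 0 < z) (a : ℝ) : (Complex.I * z + a : ℂ) ≠ 0 := fun h => by
  have := congrArg Complex.im h
  simp at this
  exact hz.ne' this

lemma two_mul_div_sq_add_sq {z a : ℂ} (h₁ : Complex.I * z + a ≠ 0) (h₂ : Complex.I * z - a ≠ 0) :
    2 * z / (z ^ 2 + a ^ 2) = Complex.I * (1 / (Complex.I * z + a) + 1 / (Complex.I * z - a)) := by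
  have f : z ^ 2 + a ^ 2 = -((Complex.I * z + a) * (Complex.I * z - a)) := by
    linear_combination z ^ 2 * Complex.I_sq
  rw [f, div_add_div _ _ h₁ h₂, ← mul_div_assoc,
    div_eq_div_iff (neg_ne_zero.mpr (mul_ne_zero h₁ h₂)) (mul_ne_zero h₁ h₂)]
  linear_combination 2 * z * (Complex.I * z + a) * (Complex.I * z - a) * Complex.I_sq

lemma two_mul_cube_sub_div_sq_add_sq_cube {z a : ℂ} (h₁ : Complex.I * z + a ≠ 0)
    (h₂ : Complex.I * z - a ≠ 0) :
    2 * (z ^ 3 - 3 * z * a ^ 2) / (z ^ 2 + a ^ 2) ^ 3 =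
      -Complex.I * (1 / (Complex.I * z + a) ^ 3 + 1 / (Complex.I * z - a) ^ 3) := by
  have f : z ^ 2 + a ^ 2 = -((Complex.I * z + a) * (Complex.I * z - a)) := by
    linear_combination z ^ 2 * Complex.I_sq
  have h₁' := pow_ne_zero 3 h₁
  have h₂' := pow_ne_zero 3 h₂
  have g : (z ^ 2 + a ^ 2) ^ 3 = -((Complex.I * z + a) ^ 3 * (Complex.I * z - a) ^ 3) := by
    rw [f]; ring
  rw [g, div_add_div _ _ h₁' h₂', ← mul_div_assoc,
    div_eq_div_iff (neg_ne_zero.mpr (mul_ne_zero h₁' h₂')) (mul_ne_zero h₁' h₂')]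
  linear_combination (-2 * z ^ 3 * (Complex.I ^ 2 - 1) - 6 * z * a ^ 2) *
    ((Complex.I * z + a) ^ 3 * (Complex.I * z - a) ^ 3) * Complex.I_sq

lemma hasSum_tanh (hz : 0 < z) :
    HasSum (fun n => 2 * z / (z ^ 2 + tanhPole n ^ 2)) (Real.tanh z) := by
  rw [hasSum_iff_tendsto_nat_of_nonneg (fun n => by positivity)]
  set x : ℂ := 1 / 2 + Complex.I * z / π with hx
  have hpi : (π : ℂ) ≠ 0 := by exact_mod_cast pi_ne_zero
  have hmem : x ∈ Complex.integerComplement :=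
    UpperHalfPlane.coe_mem_integerComplement ⟨x, half_add_mem_upperHalfPlaneSet hz⟩
  have hcot := tendsto_logDeriv_euler_cot_sub hmem
  have hlim : Tendsto (fun n : ℕ => 1 / (x + n)) atTop (𝓝 0) := by
    have h1 : Tendsto (fun n : ℕ => ‖x + n‖) atTop atTop := by
      have h2 : Tendsto (fun n : ℕ => (n : ℝ) - ‖x‖) atTop atTop :=
        tendsto_atTop_add_const_right _ _ tendsto_natCast_atTop_atTop
      refine tendsto_atTop_mono (fun n => ?_) h2
      have := norm_sub_le (x + n) x
      simp at this
      linarith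
    simpa [Function.comp_def] using (tendsto_inv₀_cobounded.comp (tendsto_norm_atTop_iff_cobounded.mp h1))
  have hpart (N : ℕ) : ((∑ n ∈ Finset.range N, 2 * z / (z ^ 2 + tanhPole n ^ 2) : ℝ) : ℂ) =
      Complex.I / π * (∑ n ∈ Finset.range N, cotTerm x n + 1 / x - 1 / (x + N)) := by
    induction N with
    | zero => simp
    | succ N ih =>
      rw [Finset.sum_range_succ, Finset.sum_range_succ, Complex.ofReal_add, ih]
      have key : ((2 * z / (z ^ 2 + tanhPole N ^ 2) : ℝ) : ℂ) =
          Complex.I / π * (1 / (x + N) + 1 / (x + -(N + 1))) := by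
        rw [hx, half_add_add_eq, half_add_add_eq]
        have e1 : ((2 * N + 1) * π / 2 : ℂ) = (tanhPole N : ℝ) := by
          simp [tanhPole]
        have e2 : ((2 * (-(N + 1)) + 1) * π / 2 : ℂ) = ((-tanhPole N : ℝ) : ℂ) := by
          simp [tanhPole]; ring
        rw [e1, e2]
        have n1 := I_mul_add_ne_zero hz (tanhPole N)
        have n2 := I_mul_add_ne_zero hz (-tanhPole N)
        push_cast at n2 ⊢
        rw [← sub_eq_add_neg] at n2 ⊢
        rw [two_mul_div_sq_add_sq n1 n2]
        field_simp
      rw [key, cotTerm]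
      push_cast
      ring
  have hmain : Tendsto (fun N : ℕ =>
      ((∑ n ∈ Finset.range N, 2 * z / (z ^ 2 + tanhPole n ^ 2) : ℝ) : ℂ)) atTop
      (𝓝 ((Real.tanh z : ℝ) : ℂ)) := by
    simp_rw [hpart]
    convert (((hcot.add_const (1 / x)).sub hlim).const_mul (Complex.I / π)) using 2
    rw [Complex.cot, hx, sin_pi_mul_half_add, cos_pi_mul_half_add, Real.tanh_eq_sinh_div_cosh]
    have : (Real.cosh z : ℂ) ≠ 0 := by exact_mod_cast (Real.cosh_pos z).ne'
    rw [Complex.ofReal_div, sub_zero, sub_add_cancel]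
    field_simp
    linear_combination (Real.sinh z : ℂ) * Complex.I_sq
  exact tendsto_ofReal_iff.mp hmain

lemma iteratedDerivWithin_two_pi_mul_cot {x : ℂ} (hx : x ∈ UpperHalfPlane.upperHalfPlaneSet) :
    iteratedDerivWithin 2 (fun x : ℂ => π * Complex.cot (π * x))
      UpperHalfPlane.upperHalfPlaneSet x =
      2 * π ^ 3 * Complex.cos (π * x) / Complex.sin (π * x) ^ 3 := by
  have hU := UpperHalfPlane.isOpen_upperHalfPlaneSet
  have hsin {y : ℂ} (hy : y ∈ UpperHalfPlane.upperHalfPlaneSet) : Complex.sin (π * y) ≠ 0 :=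
    sin_pi_mul_ne_zero (UpperHalfPlane.coe_mem_integerComplement ⟨y, hy⟩)
  have hds (y : ℂ) : HasDerivAt (fun y : ℂ => Complex.sin (π * y)) (Complex.cos (π * y) * π) y := by
    simpa using ((hasDerivAt_id y).const_mul (π : ℂ)).csin
  have hdc (y : ℂ) : HasDerivAt (fun y : ℂ => Complex.cos (π * y))
      (-Complex.sin (π * y) * π) y := by
    simpa using ((hasDerivAt_id y).const_mul (π : ℂ)).ccos
  have hd1 {y : ℂ} (hy : y ∈ UpperHalfPlane.upperHalfPlaneSet) :
      deriv (fun x : ℂ => π * Complex.cot (π * x)) y = -π ^ 2 / Complex.sin (π * y) ^ 2 := by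
    have := (((hdc y).div (hds y) (hsin hy)).const_mul (π : ℂ)).deriv
    simp only [Complex.cot]
    refine Eq.trans this ?_
    have h0 := hsin hy
    field_simp
    linear_combination -Complex.sin_sq_add_cos_sq (π * y)
  rw [iteratedDerivWithin_of_isOpen hU hx, iteratedDeriv_succ, iteratedDeriv_one]
  have heq : deriv (fun x : ℂ => π * Complex.cot (π * x)) =ᶠ[𝓝 x]
      fun y => -π ^ 2 / Complex.sin (π * y) ^ 2 :=
    (hU.eventually_mem hx).mono fun y hy => hd1 hy
  rw [heq.deriv_eq]
  have h0 := hsin hx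
  have := ((hasDerivAt_const x (-π ^ 2 : ℂ)).div ((hds x).pow 2) (pow_ne_zero 2 h0)).deriv
  refine Eq.trans this ?_
  simp only [Pi.pow_apply]
  field_simp
  push_cast
  ring

lemma hasSum_tanh_pow_three_sub_tanh (hz : 0 < z) :
    HasSum (fun n => 2 * (z ^ 3 - 3 * z * tanhPole n ^ 2) / (z ^ 2 + tanhPole n ^ 2) ^ 3)
      (Real.tanh z ^ 3 - Real.tanh z) := by
  set x : ℂ := 1 / 2 + Complex.I * z / π with hx
  have hpi : (π : ℂ) ≠ 0 := by exact_mod_cast pi_ne_zero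
  have hmem := half_add_mem_upperHalfPlaneSet hz
  have hsum : Summable fun n : ℤ => 1 / (x + n) ^ 3 := by
    have := EisensteinSeries.linear_right_summable x 1 (k := 3) (by norm_num)
    simpa using this
  have hval := iteratedDerivWithin_cot_pi_mul_eq_mul_tsum_div_pow (k := 2) (by norm_num) hmem
  rw [iteratedDerivWithin_two_pi_mul_cot hmem, sin_pi_mul_half_add, cos_pi_mul_half_add] at hval
  have h := hsum.hasSum.nat_add_neg_add_one.mul_left (-Complex.I / π ^ 3)
  have hc : (Real.cosh z : ℂ) ≠ 0 := by exact_mod_cast (Real.cosh_pos z).ne'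
  rw [← Complex.hasSum_ofReal]
  convert! h using 1
  · ext N
    push_cast
    rw [hx, half_add_add_eq, half_add_add_eq]
    have e1 : ((2 * N + 1) * π / 2 : ℂ) = (tanhPole N : ℝ) := by
      simp [tanhPole]
    have e2 : ((2 * (-(N + 1)) + 1) * π / 2 : ℂ) = ((-tanhPole N : ℝ) : ℂ) := by
      simp [tanhPole]; ring
    rw [e1, e2]
    have n1 := I_mul_add_ne_zero hz (tanhPole N)
    have n2 := I_mul_add_ne_zero hz (-tanhPole N)
    push_cast at n2 ⊢
    rw [← sub_eq_add_neg] at n2 ⊢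
    rw [two_mul_cube_sub_div_sq_add_sq_cube n1 n2, div_pow, div_pow]
    field_simp
  · have hid : Real.tanh z ^ 3 - Real.tanh z = - (Real.sinh z / Real.cosh z ^ 3) := by
      have := Real.cosh_sq z
      have h0 := (Real.cosh_pos z).ne'
      rw [Real.tanh_eq_sinh_div_cosh]
      field_simp
      rw [this]; ring
    have hs : ∑' n : ℤ, 1 / (x + n) ^ 3 =
        -(π ^ 3 * Real.sinh z * Complex.I) / Real.cosh z ^ 3 := by
      norm_num at hval
      norm_num
      linear_combination -hval / 2
    rw [hs, hid]
    push_cast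
    push_cast at hc
    field_simp
    simp

end PartialFractions

lemma tendsto_div_one_add_sq_pow_atTop {k : ℕ} (hk : k ≠ 0) :
    Tendsto (fun t : ℝ => t / (1 + t ^ 2) ^ k) atTop (𝓝 0) := by
  refine squeeze_zero' (g := fun t : ℝ => t⁻¹) ?_ ?_ tendsto_inv_atTop_zero
  · filter_upwards [eventually_gt_atTop 0] with t ht
    positivity
  · filter_upwards [eventually_gt_atTop 0] with t ht
    rw [inv_eq_one_div, div_le_div_iff₀ (by positivity) ht]
    have : 1 + t ^ 2 ≤ (1 + t ^ 2) ^ k := le_self_pow₀ (by nlinarith) hk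
    nlinarith

/-- The rational function arising from the third order part of the partial fraction expansion of
`tanh z ^ 3 / z ^ 3`, normalised to have poles at `± I`. -/
noncomputable def cubicProfile (t : ℝ) : ℝ :=
  6 / (1 + t ^ 2) + 6 / (1 + t ^ 2) ^ 2 + 8 / (1 + t ^ 2) ^ 3

lemma cubicProfile_nonneg (t : ℝ) : 0 ≤ cubicProfile t := by
  unfold cubicProfile; positivity

lemma hasDerivAt_primitive_cubicProfile (t : ℝ) :
    HasDerivAt (fun t => 12 * arctan t + 6 * (t / (1 + t ^ 2) ^ 1) + 2 * (t / (1 + t ^ 2) ^ 2))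
      (cubicProfile t) t := by
  have hu : HasDerivAt (fun t : ℝ => 1 + t ^ 2) (2 * t) t := by
    simpa using (hasDerivAt_pow 2 t).const_add 1
  have hpos : 0 < 1 + t ^ 2 := by positivity
  have h (k : ℕ) := (hasDerivAt_id t).div (hu.pow k) (pow_ne_zero k hpos.ne')
  convert! (((hasDerivAt_arctan t).const_mul 12).add ((h 1).const_mul 6)).add
    ((h 2).const_mul 2) using 1
  simp only [cubicProfile, Pi.pow_apply, id]
  field_simp
  norm_num
  ring

lemma tendsto_primitive_cubicProfile :
    Tendsto (fun t => 12 * arctan t + 6 * (t / (1 + t ^ 2) ^ 1) + 2 * (t / (1 + t ^ 2) ^ 2)) atTop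
      (𝓝 (6 * π)) := by
  have h := (((tendsto_nhds_of_tendsto_nhdsWithin tendsto_arctan_atTop).const_mul 12).add
    ((tendsto_div_one_add_sq_pow_atTop one_ne_zero).const_mul 6)).add
    ((tendsto_div_one_add_sq_pow_atTop two_ne_zero).const_mul 2)
  convert h using 2
  ring

lemma integrableOn_cubicProfile : IntegrableOn cubicProfile (Set.Ioi 0) :=
  integrableOn_Ioi_deriv_of_nonneg
    (hasDerivAt_primitive_cubicProfile 0).continuousAt.continuousWithinAt
    (fun t _ => hasDerivAt_primitive_cubicProfile t) (fun t _ => cubicProfile_nonneg t)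
    tendsto_primitive_cubicProfile

lemma integral_cubicProfile : ∫ t in Set.Ioi 0, cubicProfile t = 6 * π := by
  rw [integral_Ioi_of_hasDerivAt_of_nonneg
    (hasDerivAt_primitive_cubicProfile 0).continuousAt.continuousWithinAt
    (fun t _ => hasDerivAt_primitive_cubicProfile t) (fun t _ => cubicProfile_nonneg t)
    tendsto_primitive_cubicProfile]
  simp

/-- The `n`-th term of the regularised partial fraction expansion of `tanh z ^ 3 / z ^ 3`. -/
noncomputable def tanhCubeTerm (n : ℕ) (z : ℝ) : ℝ :=
  1 / tanhPole n ^ 6 * cubicProfile ((tanhPole n)⁻¹ * z) -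
    2 / tanhPole n ^ 4 * (1 + ((tanhPole n)⁻¹ * z) ^ 2)⁻¹

lemma hasSum_tanhCubeTerm {z : ℝ} (hz : 0 < z) :
    HasSum (fun n => tanhCubeTerm n z) (Real.tanh z ^ 3 / z ^ 3) := by
  have h := ((((hasSum_tanh hz).add (hasSum_tanh_pow_three_sub_tanh hz)).sub
    (hasSum_one_div_tanhPole_sq.mul_left (2 * z))).add
    (hasSum_one_div_tanhPole_pow_four.mul_left (6 * z))).div_const (z ^ 3)
  convert! h using 1
  · ext n
    have ha := tanhPole_pos n
    rw [tanhCubeTerm, cubicProfile]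
    generalize tanhPole n = a at *
    have h1 : 1 + (a⁻¹ * z) ^ 2 = (z ^ 2 + a ^ 2) / a ^ 2 := by field_simp; ring
    rw [h1]
    field_simp
    ring
  · ring

lemma integrableOn_comp_inv_tanhPole_mul {f : ℝ → ℝ} (hf : IntegrableOn f (Set.Ioi 0)) (n : ℕ) :
    IntegrableOn (fun z => f ((tanhPole n)⁻¹ * z)) (Set.Ioi 0) := by
  rw [integrableOn_Ioi_comp_mul_left_iff f 0 (inv_pos.mpr (tanhPole_pos n)), mul_zero]
  exact hf

lemma integral_comp_inv_tanhPole_mul (f : ℝ → ℝ) (n : ℕ) :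
    ∫ z in Set.Ioi 0, f ((tanhPole n)⁻¹ * z) = tanhPole n * ∫ z in Set.Ioi 0, f z := by
  rw [integral_comp_mul_left_Ioi f 0 (inv_pos.mpr (tanhPole_pos n)), mul_zero, inv_inv, smul_eq_mul]

lemma integrableOn_cubic_part (n : ℕ) :
    IntegrableOn (fun z => 1 / tanhPole n ^ 6 * cubicProfile ((tanhPole n)⁻¹ * z)) (Set.Ioi 0) :=
  (integrableOn_comp_inv_tanhPole_mul integrableOn_cubicProfile n).const_mul _

lemma integrableOn_simple_part (n : ℕ) :
    IntegrableOn (fun z => 2 / tanhPole n ^ 4 * (1 + ((tanhPole n)⁻¹ * z) ^ 2)⁻¹) (Set.Ioi 0) :=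
  (integrableOn_comp_inv_tanhPole_mul (f := fun t => (1 + t ^ 2)⁻¹)
    integrable_inv_one_add_sq.integrableOn n).const_mul _

lemma integral_cubic_part (n : ℕ) :
    ∫ z in Set.Ioi 0, 1 / tanhPole n ^ 6 * cubicProfile ((tanhPole n)⁻¹ * z) =
      6 * π * (1 / tanhPole n ^ 5) := by
  have := (tanhPole_pos n).ne'
  rw [integral_const_mul, integral_comp_inv_tanhPole_mul, integral_cubicProfile]
  field_simp

lemma integral_simple_part (n : ℕ) :
    ∫ z in Set.Ioi 0, 2 / tanhPole n ^ 4 * (1 + ((tanhPole n)⁻¹ * z) ^ 2)⁻¹ =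
      π * (1 / tanhPole n ^ 3) := by
  have := (tanhPole_pos n).ne'
  rw [integral_const_mul, integral_comp_inv_tanhPole_mul (fun t => (1 + t ^ 2)⁻¹),
    integral_Ioi_inv_one_add_sq, arctan_zero]
  field_simp
  ring

lemma integrableOn_tanhCubeTerm (n : ℕ) : IntegrableOn (tanhCubeTerm n) (Set.Ioi 0) :=
  (integrableOn_cubic_part n).sub (integrableOn_simple_part n)

lemma integral_tanhCubeTerm (n : ℕ) :
    ∫ z in Set.Ioi 0, tanhCubeTerm n z =
      6 * π * (1 / tanhPole n ^ 5) - π * (1 / tanhPole n ^ 3) := by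
  rw [← integral_cubic_part, ← integral_simple_part,
    ← integral_sub (integrableOn_cubic_part n) (integrableOn_simple_part n)]
  rfl

lemma integral_norm_tanhCubeTerm_le (n : ℕ) :
    ∫ z in Set.Ioi 0, ‖tanhCubeTerm n z‖ ≤
      6 * π * (1 / tanhPole n ^ 5) + π * (1 / tanhPole n ^ 3) := by
  rw [← integral_cubic_part, ← integral_simple_part,
    ← integral_add (integrableOn_cubic_part n) (integrableOn_simple_part n)]
  refine integral_mono (integrableOn_tanhCubeTerm n).norm
    ((integrableOn_cubic_part n).add (integrableOn_simple_part n)) fun z => ?_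
  have ha := tanhPole_pos n
  have h₁ : 0 ≤ 1 / tanhPole n ^ 6 * cubicProfile ((tanhPole n)⁻¹ * z) :=
    mul_nonneg (by positivity) (cubicProfile_nonneg _)
  have h₂ : 0 ≤ 2 / tanhPole n ^ 4 * (1 + ((tanhPole n)⁻¹ * z) ^ 2)⁻¹ := by positivity
  refine (norm_sub_le _ _).trans_eq ?_
  rw [Real.norm_of_nonneg h₁, Real.norm_of_nonneg h₂]

lemma integral_tanh_pow_three_div_pow_three :
    ∫ z in Set.Ioi (0 : ℝ), Real.tanh z ^ 3 / z ^ 3 =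
      -7 * (∑' n : ℕ, 1 / (n : ℝ) ^ 3) / π ^ 2 + 186 * (∑' n : ℕ, 1 / (n : ℝ) ^ 5) / π ^ 4 := by
  have h₅ := (hasSum_one_div_tanhPole_pow (s := 5) (by norm_num)).mul_left (6 * π)
  have h₃ := (hasSum_one_div_tanhPole_pow (s := 3) (by norm_num)).mul_left π
  have hsum : Summable fun n => ∫ z in Set.Ioi 0, ‖tanhCubeTerm n z‖ :=
    (h₅.add h₃).summable.of_nonneg_of_le (fun n => integral_nonneg fun z => norm_nonneg _)
      integral_norm_tanhCubeTerm_le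
  have h := hasSum_integral_of_summable_integral_norm integrableOn_tanhCubeTerm hsum
  simp_rw [integral_tanhCubeTerm] at h
  rw [setIntegral_congr_fun measurableSet_Ioi fun z hz => (hasSum_tanhCubeTerm hz).tsum_eq] at h
  rw [h.unique (h₅.sub h₃)]
  field_simp
  ring

theorem stmt_1 :
    (↑(∫ z in Set.Ioi (0:ℝ), Real.tanh z ^ 3 / z ^ 3) : ℂ) = -7 * riemannZeta 3 / (π:ℂ) ^ 2 + 186 * riemannZeta 5 / (π:ℂ) ^ 4 := by
  have h₃ := zeta_nat_eq_tsum_of_gt_one (k := 3) (by norm_num)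
  have h₅ := zeta_nat_eq_tsum_of_gt_one (k := 5) (by norm_num)
  rw [integral_tanh_pow_three_div_pow_three]
  push_cast at h₃ h₅ ⊢
  rw [h₃, h₅]
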